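/- arXiv:2505.03627 — 2 statements merged into one kernel-verified Lean document; each statement's English description precedes it below -/
import Mathlib

section
/- Let Π be a finite set with |Π| = n, let e, f be natural numbers with e + f ≤ n and n ≥ 2e + f − 1, let V be a type of values, let vote : Π → Option V assign to each process at most one voted value, and let Q ⊆ Π with |Q| = n − f. Then there is at most one value v ∈ V such that the number of elements q ∈ Q with vote q = some v is strictly greater than n − e − f. -/
/-- Uniqueness of a value receiving strictly more than `n - e - f` votes within a
quorum `Q` of cardinality `n - f`, assuming `e + f ≤ n` and `n ≥ 2e + f - 1`. -/
theorem unique_value_above_threshold {α : Type*} [Fintype α] [DecidableEq α]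
    {V : Type*} [DecidableEq V]
    (n e f : ℕ) (hcard : Fintype.card α = n) (hef : e + f ≤ n)
    (hn : 2 * e + f ≤ n + 1)
    (vote : α → Option V) (Q : Finset α) (hQ : Q.card = n - f) :
    ∀ v v' : V,
      n - e - f < (Q.filter (fun q => vote q = some v)).card →
      n - e - f < (Q.filter (fun q => vote q = some v')).card →
      v = v' := by
  intro v v' hv hv'
  by_contra hne
  have hdisj : Disjoint (Q.filter (fun q => vote q = some v))
      (Q.filter (fun q => vote q = some v')) :=
    Finset.disjoint_filter.2 fun q _ h h' => hne (Option.some.inj (h.symm.trans h'))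
  have hle := Finset.card_le_card (Finset.union_subset
    (Finset.filter_subset (fun q => vote q = some v) Q)
    (Finset.filter_subset (fun q => vote q = some v') Q))
  rw [Finset.card_union_of_disjoint hdisj] at hle
  omega
end

section
/- Let Π be a finite set with |Π| = n, let e, f be natural numbers with n ≥ 2e + f, let V be a type of values, let vote : Π → Option V, let v ∈ V, and let Q ⊆ Π with |Q| = n − f. If the number of elements of Π voting for v is at least n − e, then: (i) the number of elements of Q voting for v is at least n − e − f; (ii) for every value v' ≠ v, the number of elements of Q voting for v' is at most e; and (iii) e ≤ n − e − f, so v attains the maximum vote count within Q. -/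
/-- Fast-path recovery counting for the consensus task (`n ≥ 2e + f`): within a
quorum `Q` of cardinality `n - f`, a value `v` voted for by at least `n - e`
processes overall receives at least `n - e - f` votes, any other value receives
at most `e` votes, `e ≤ n - e - f`, and hence `v` attains the maximum vote count
within `Q`. -/
theorem fast_path_recovery_task {α : Type*} [Fintype α] [DecidableEq α]
    {V : Type*} [DecidableEq V]
    (n e f : ℕ) (hcard : Fintype.card α = n) (hn : 2 * e + f ≤ n)
    (vote : α → Option V) (v : V) (Q : Finset α) (hQ : Q.card = n - f)
    (hglobal : n - e ≤ (Finset.univ.filter (fun p => vote p = some v)).card) :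
    (n - e - f ≤ (Q.filter (fun q => vote q = some v)).card) ∧
    (∀ v' : V, v' ≠ v → (Q.filter (fun q => vote q = some v')).card ≤ e) ∧
    (e ≤ n - e - f) ∧
    (∀ v' : V, (Q.filter (fun q => vote q = some v')).card ≤
      (Q.filter (fun q => vote q = some v)).card) := by
  have hQv := Q.card_filter_add_card_filter_not (fun q => vote q = some v)
  have huniv := Finset.univ.card_filter_add_card_filter_not (fun q => vote q = some v)
  rw [Finset.card_univ] at huniv
  have hmono : (Q.filter (fun q => ¬ vote q = some v)).card ≤
      (Finset.univ.filter (fun q => ¬ vote q = some v)).card :=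
    Finset.card_le_card (Finset.filter_subset_filter _ (Finset.subset_univ Q))
  have hother : ∀ v' : V, v' ≠ v → (Q.filter (fun q => vote q = some v')).card ≤ e := by
    intro v' hne
    have hle : (Q.filter (fun q => vote q = some v')).card ≤
        (Q.filter (fun q => ¬ vote q = some v)).card :=
      Finset.card_le_card (Finset.monotone_filter_right Q fun q _ hq hv =>
        hne (Option.some.inj (hq.symm.trans hv)))
    omega
  refine ⟨by omega, hother, by omega, fun v' => ?_⟩
  by_cases h : v' = v
  · rw [h]
  · have := hother v' h
    omega
end
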